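/- Let n = 2ν be even and J₀ := I_ν ⊗ [[0,1],[-1,0]] the canonical antisymmetric matrix of order n, and let J₁, J₂ be antisymmetric matrices. Suppose the matrices a ∈ ℝ^{n×n}, b ∈ ℝ^{n×m₂}, c ∈ ℝ^{p₂×n}, d ∈ ℝ^{p₂×m₂}, e ∈ ℝ^{n×p₁} satisfy the physical realizability conditions a J₀ + J₀ aᵀ + e D J₁ Dᵀ eᵀ + b J₂ bᵀ = 0 and c J₀ + d J₂ bᵀ = 0, where D ∈ ℝ^{p₁×m₁}. Then for every symplectic matrix σ ∈ ℝ^{n×n} (i.e., σ J₀ σᵀ = J₀), the transformed matrices σ a σ⁻¹, σ b, c σ⁻¹, σ e satisfy the same physical realizability conditions: (σaσ⁻¹) J₀ + J₀ (σaσ⁻¹)ᵀ + (σe) D J₁ Dᵀ (σe)ᵀ + (σb) J₂ (σb)ᵀ = 0 and (cσ⁻¹) J₀ + d J₂ (σb)ᵀ = 0. -/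

import Mathlib

open Matrix
open scoped Kronecker

/-- The canonical antisymmetric matrix `J₀ = I_ν ⊗ [[0,1],[-1,0]]` of (even) order `n = 2ν`. -/
noncomputable def J0 (ν : ℕ) : Matrix (Fin ν × Fin 2) (Fin ν × Fin 2) ℝ :=
  (1 : Matrix (Fin ν) (Fin ν) ℝ) ⊗ₖ !![(0 : ℝ), 1; -1, 0]

lemma J0_mul_J0 (ν : ℕ) : J0 ν * J0 ν = -1 := by
  have h : !![(0 : ℝ), 1; -1, 0] * !![(0 : ℝ), 1; -1, 0] = -1 := by
    ext i j
    fin_cases i <;> fin_cases j <;> simp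
  rw [J0, ← mul_kronecker_mul, h, mul_one, ← neg_one_smul ℝ (1 : Matrix (Fin 2) (Fin 2) ℝ),
    kronecker_smul, one_kronecker_one, neg_one_smul]

lemma isUnit_det_of_symplectic {ν : ℕ} {σ : Matrix (Fin ν × Fin 2) (Fin ν × Fin 2) ℝ}
    (hσ : σ * J0 ν * σᵀ = J0 ν) : IsUnit σ.det := by
  refine isUnit_det_of_right_inverse (B := -(J0 ν * σᵀ * J0 ν)) ?_
  rw [mul_neg, ← mul_assoc, ← mul_assoc, hσ, J0_mul_J0, neg_neg]

theorem stmt_4 (ν m₁ m₂ p₁ p₂ : ℕ)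
    (J₁ : Matrix (Fin m₁) (Fin m₁) ℝ) (hJ₁ : J₁ᵀ = -J₁)
    (J₂ : Matrix (Fin m₂) (Fin m₂) ℝ) (hJ₂ : J₂ᵀ = -J₂)
    (a : Matrix (Fin ν × Fin 2) (Fin ν × Fin 2) ℝ)
    (b : Matrix (Fin ν × Fin 2) (Fin m₂) ℝ)
    (c : Matrix (Fin p₂) (Fin ν × Fin 2) ℝ)
    (d : Matrix (Fin p₂) (Fin m₂) ℝ)
    (e : Matrix (Fin ν × Fin 2) (Fin p₁) ℝ)
    (D : Matrix (Fin p₁) (Fin m₁) ℝ)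
    -- physical realizability conditions
    (hPR1 : a * J0 ν + J0 ν * aᵀ + e * D * J₁ * Dᵀ * eᵀ + b * J₂ * bᵀ = 0)
    (hPR2 : c * J0 ν + d * J₂ * bᵀ = 0)
    -- a symplectic matrix
    (σ : Matrix (Fin ν × Fin 2) (Fin ν × Fin 2) ℝ) (hσ : σ * J0 ν * σᵀ = J0 ν) :
    (σ * a * σ⁻¹) * J0 ν + J0 ν * (σ * a * σ⁻¹)ᵀ +
        (σ * e) * D * J₁ * Dᵀ * (σ * e)ᵀ + (σ * b) * J₂ * (σ * b)ᵀ = 0 ∧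
    (c * σ⁻¹) * J0 ν + d * J₂ * (σ * b)ᵀ = 0 := by
  have hu := isUnit_det_of_symplectic hσ
  have hinv : σ⁻¹ * J0 ν = J0 ν * σᵀ := by
    conv_lhs => rw [← hσ]
    rw [mul_assoc, nonsing_inv_mul_cancel_left _ _ hu]
  have hinvT : J0 ν * σ⁻¹ᵀ = σ * J0 ν := by
    conv_lhs => rw [← hσ]
    rw [mul_assoc, ← transpose_mul, nonsing_inv_mul _ hu, transpose_one, mul_one]
  constructor
  · have h₁ : σ * a * σ⁻¹ * J0 ν = σ * (a * J0 ν) * σᵀ := by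
      rw [mul_assoc, hinv]
      simp only [mul_assoc]
    have h₂ : J0 ν * (σ * a * σ⁻¹)ᵀ = σ * (J0 ν * aᵀ) * σᵀ := by
      rw [transpose_mul, transpose_mul, ← mul_assoc, hinvT]
      simp only [mul_assoc]
    have h := congrArg (fun M => σ * M * σᵀ) hPR1
    simp only [mul_add, add_mul, mul_zero, zero_mul] at h
    rw [h₁, h₂, ← h]
    simp only [transpose_mul, Matrix.mul_assoc]
  · have h := congrArg (· * σᵀ) hPR2
    simp only [Matrix.add_mul, Matrix.zero_mul] at h
    rw [Matrix.mul_assoc c, hinv, ← h]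
    simp only [transpose_mul, Matrix.mul_assoc]
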